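/- arXiv:2403.14536 — 4 statements merged into one kernel-verified Lean document; each statement's English description precedes it below -/
import Mathlib

section
/- Let n ≥ 2, let a < b be real numbers, and let X₁, …, Xₙ be independent random variables, each uniformly distributed on the interval [a, b]. Let m = min{X₁, …, Xₙ} and M = max{X₁, …, Xₙ}. Then for every c ∈ (0, 1], the probability that (M − m)/(b − m) ≤ c equals c^(n−1). -/
open MeasureTheory ProbabilityTheory Set

/-- Points whose `i`-th coordinate is the strict minimum and whose ratio is at most `c`. -/
def ratioSet (k : ℕ) (b c : ℝ) (i : Fin (k + 1)) : Set (Fin (k + 1) → ℝ) :=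
  {x | ∀ j : Fin k, x (i.succAbove j) ∈ Ioc (x i) (x i + c * (b - x i))}

lemma measurableSet_ratioSet (k : ℕ) (b c : ℝ) (i : Fin (k + 1)) :
    MeasurableSet (ratioSet k b c i) := by
  have : ratioSet k b c i = ⋂ j : Fin k, ({x | x i < x (i.succAbove j)} ∩
      {x | x (i.succAbove j) ≤ x i + c * (b - x i)}) := by
    ext x; simp [ratioSet]
  rw [this]
  refine MeasurableSet.iInter fun j => MeasurableSet.inter ?_ ?_
  · exact measurableSet_lt (by fun_prop) (by fun_prop)
  · exact measurableSet_le (by fun_prop) (by fun_prop)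

lemma ratioSet_measure_eq (k : ℕ) (b c : ℝ) (i : Fin (k + 1)) (u : Measure ℝ) [SigmaFinite u] :
    Measure.pi (fun _ : Fin (k + 1) => u) (ratioSet k b c i) =
      ∫⁻ x, (u (Ioc x (x + c * (b - x)))) ^ k ∂u := by
  have hp := measurePreserving_piFinSuccAbove (fun _ : Fin (k + 1) => u) i
  have hp' := hp.symm
  rw [← hp'.measure_preimage (measurableSet_ratioSet k b c i).nullMeasurableSet,
    Measure.prod_apply (hp'.measurable (measurableSet_ratioSet k b c i))]
  refine lintegral_congr fun x => ?_
  have : Prod.mk x ⁻¹' ((MeasurableEquiv.piFinSuccAbove (fun _ => ℝ) i).symm ⁻¹'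
      ratioSet k b c i) = Set.pi univ (fun _ => Ioc x (x + c * (b - x))) := by
    ext y
    simp [ratioSet, MeasurableEquiv.piFinSuccAbove, Fin.insertNthEquiv]
  rw [this, Measure.pi_pi]
  simp

lemma ratioSet_disjoint (k : ℕ) (b c : ℝ) :
    Pairwise (Function.onFun Disjoint (ratioSet k b c)) := by
  intro i j hij
  rw [Function.onFun, Set.disjoint_left]
  intro x hi hj
  obtain ⟨p, hp⟩ := Fin.exists_succAbove_eq hij
  obtain ⟨q, hq⟩ := Fin.exists_succAbove_eq hij.symm
  have h1 := (hi q).1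
  have h2 := (hj p).1
  rw [hq] at h1
  rw [hp] at h2
  exact lt_asymm h1 h2

lemma ratioSet_scale (k : ℕ) (a b c : ℝ) (hc : c ∈ Ioc (0 : ℝ) 1)
    (i : Fin (k + 1)) (u : Measure ℝ) [SigmaFinite u]
    (hu : u = (ENNReal.ofReal (b - a))⁻¹ • volume.restrict (Icc a b)) :
    Measure.pi (fun _ : Fin (k + 1) => u) (ratioSet k b c i) =
      ENNReal.ofReal c ^ k * Measure.pi (fun _ : Fin (k + 1) => u) (ratioSet k b 1 i) := by
  rw [ratioSet_measure_eq, ratioSet_measure_eq, ← lintegral_const_mul' _ _ (by simp)]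
  have hae : ∀ᵐ x ∂u, x ∈ Icc a b := by
    rw [hu]
    exact Measure.ae_smul_measure (ae_restrict_mem measurableSet_Icc) _
  refine lintegral_congr_ae ?_
  filter_upwards [hae] with x hx
  rw [← mul_pow]
  congr 1
  have key : ∀ d ∈ Ioc (0 : ℝ) 1, u (Ioc x (x + d * (b - x))) =
      (ENNReal.ofReal (b - a))⁻¹ * (ENNReal.ofReal d * ENNReal.ofReal (b - x)) := by
    intro d hd
    have hsub : Ioc x (x + d * (b - x)) ⊆ Icc a b := by
      intro y hy
      refine ⟨hx.1.trans hy.1.le, hy.2.trans ?_⟩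
      nlinarith [hd.2, hx.2]
    rw [hu, Measure.smul_apply, Measure.restrict_apply measurableSet_Ioc,
      inter_eq_left.2 hsub, Real.volume_Ioc, smul_eq_mul, ← ENNReal.ofReal_mul hd.1.le]
    congr 2
    ring
  rw [key c hc, key 1 (by simp), ENNReal.ofReal_one, one_mul]
  ring

lemma ratio_iff (k : ℕ) (b c : ℝ) (x : Fin (k + 1) → ℝ) (hb : ∀ i, x i < b)
    (hne : ∀ i j, i ≠ j → x i ≠ x j) (hc : 0 < c) :
    ((⨆ i, x i) - ⨅ i, x i) / (b - ⨅ i, x i) ≤ c ↔ x ∈ ⋃ i, ratioSet k b c i := by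
  obtain ⟨i, hi⟩ := exists_eq_ciInf_of_finite (f := x)
  have hle : ∀ j, x i ≤ x j := fun j => hi ▸ ciInf_le (Set.finite_range x).bddBelow j
  have hpos : 0 < b - x i := sub_pos.2 (hb i)
  rw [← hi, div_le_iff₀ hpos, sub_le_iff_le_add', ciSup_le_iff (Set.finite_range x).bddAbove,
    mem_iUnion]
  constructor
  · intro h
    exact ⟨i, fun j => ⟨lt_of_le_of_ne (hle _) (hne _ _ (Fin.succAbove_ne i j).symm), h _⟩⟩
  · rintro ⟨l, hl⟩ j
    have hil : i = l := by
      by_contra hil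
      obtain ⟨p, hp⟩ := Fin.exists_succAbove_eq hil
      have := (hl p).1
      rw [hp] at this
      exact absurd (hle l) (not_le.2 this)
    subst hil
    by_cases hj : j = i
    · subst hj
      nlinarith
    · obtain ⟨p, hp⟩ := Fin.exists_succAbove_eq hj
      have := (hl p).2
      rwa [hp] at this

/-- For `n ≥ 2` i.i.d. samples uniform on `[a, b]` (`a < b`), with
`m = min i, X i` and `M = max i, X i`, for every `c ∈ (0, 1]` the probability
that `(M - m) / (b - m) ≤ c` equals `c ^ (n - 1)`. -/
theorem uniform_range_ratio_cdf
    {Ω : Type*} [MeasurableSpace Ω] (μ : Measure Ω) [IsProbabilityMeasure μ]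
    (n : ℕ) (hn : 2 ≤ n) (a b : ℝ) (hab : a < b)
    (X : Fin n → Ω → ℝ) (hmeas : ∀ i, Measurable (X i))
    (hindep : iIndepFun X μ)
    (hunif : ∀ i, Measure.map (X i) μ =
      (ENNReal.ofReal (b - a))⁻¹ • volume.restrict (Icc a b))
    (c : ℝ) (hc : c ∈ Ioc (0 : ℝ) 1) :
    μ {ω | ((⨆ i, X i ω) - ⨅ i, X i ω) / (b - ⨅ i, X i ω) ≤ c} =
      ENNReal.ofReal (c ^ (n - 1)) := by
  obtain ⟨k, rfl⟩ : ∃ k, n = k + 1 := ⟨n - 1, by omega⟩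
  obtain ⟨u, hu⟩ : ∃ u : Measure ℝ,
      u = (ENNReal.ofReal (b - a))⁻¹ • volume.restrict (Icc a b) := ⟨_, rfl⟩
  rw [← hu] at hunif
  have hprob : IsProbabilityMeasure u := by
    rw [← hunif 0]
    exact Measure.isProbabilityMeasure_map (hmeas 0).aemeasurable
  have hnull : ∀ x : ℝ, u {x} = 0 := by
    intro x
    rw [hu, Measure.smul_apply, measure_singleton, smul_zero]
  have hlaw : μ.map (fun ω i => X i ω) = Measure.pi (fun _ : Fin (k + 1) => u) := by
    rw [(iIndepFun_iff_map_fun_eq_pi_map fun i => (hmeas i).aemeasurable).1 hindep]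
    simp_rw [hunif]
  have hmX : Measurable (fun ω i => X i ω) := measurable_pi_lambda _ hmeas
  have hb : ∀ᵐ ω ∂μ, ∀ i, X i ω < b := by
    rw [ae_all_iff]
    intro i
    have h : ∀ᵐ x ∂u, x < b := by
      have h1 : ∀ᵐ x ∂u, x ∈ Icc a b := by
        rw [hu]
        exact Measure.ae_smul_measure (ae_restrict_mem measurableSet_Icc) _
      have h2 : ∀ᵐ x ∂u, x ≠ b := by
        rw [ae_iff]; simpa using hnull b
      filter_upwards [h1, h2] with x hx hx'
      exact lt_of_le_of_ne hx.2 hx'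
    rw [← hunif i] at h
    exact ae_of_ae_map (hmeas i).aemeasurable h
  have hne : ∀ᵐ ω ∂μ, ∀ i j, i ≠ j → X i ω ≠ X j ω := by
    simp_rw [ae_all_iff]
    intro i j hij
    have h1 := (indepFun_iff_map_prod_eq_prod_map_map (hmeas i).aemeasurable
      (hmeas j).aemeasurable).1 (hindep.indepFun hij)
    rw [hunif, hunif] at h1
    have h2 : ∀ᵐ p ∂(u.prod u), p.1 ≠ p.2 := by
      have hm : MeasurableSet {p : ℝ × ℝ | p.1 = p.2} :=
        measurableSet_eq_fun measurable_fst measurable_snd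
      rw [ae_iff]
      simp only [not_not, ne_eq]
      rw [Measure.measure_prod_null hm]
      refine Filter.Eventually.of_forall fun x => ?_
      have : Prod.mk x ⁻¹' {p : ℝ × ℝ | p.1 = p.2} = {x} := by
        ext y; simp [eq_comm]
      change u (Prod.mk x ⁻¹' {p : ℝ × ℝ | p.1 = p.2}) = 0
      rw [this]
      exact hnull x
    rw [← h1] at h2
    exact ae_of_ae_map ((hmeas i).prodMk (hmeas j)).aemeasurable h2
  have hmain : ∀ d : ℝ, 0 < d →
      μ {ω | ((⨆ i, X i ω) - ⨅ i, X i ω) / (b - ⨅ i, X i ω) ≤ d} =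
        ∑ i, Measure.pi (fun _ : Fin (k + 1) => u) (ratioSet k b d i) := by
    intro d hd
    rw [← tsum_fintype (L := .unconditional _), ← measure_iUnion (ratioSet_disjoint k b d) (measurableSet_ratioSet k b d),
      ← hlaw, Measure.map_apply hmX (MeasurableSet.iUnion (measurableSet_ratioSet k b d))]
    refine measure_congr ?_
    rw [Filter.eventuallyEq_set]
    filter_upwards [hb, hne] with ω h1 h2
    exact ratio_iff k b d (fun i => X i ω) h1 h2 hd
  have hone : μ {ω | ((⨆ i, X i ω) - ⨅ i, X i ω) / (b - ⨅ i, X i ω) ≤ 1} = 1 := by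
    rw [← measure_univ (μ := μ)]
    refine measure_congr ?_
    rw [Filter.eventuallyEq_set]
    filter_upwards [hb] with ω h1
    simp only [mem_setOf_eq, mem_univ, iff_true]
    obtain ⟨i, hi⟩ := exists_eq_ciInf_of_finite (f := fun i => X i ω)
    have hs : (⨆ i, X i ω) ≤ b := ciSup_le fun j => (h1 j).le
    have hpos : 0 < b - X i ω := sub_pos.2 (h1 i)
    rw [← hi, div_le_one hpos]
    linarith
  rw [hmain c hc.1]
  simp_rw [ratioSet_scale k a b c hc _ u hu]
  rw [← Finset.mul_sum, ← hmain 1 one_pos, hone, mul_one, Nat.add_sub_cancel,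
    ENNReal.ofReal_pow hc.1.le]
end

section
/- Let n ≥ 2, let a < b be real numbers, and let α ∈ (0, 1). Let X₁, …, Xₙ be independent random variables, each uniformly distributed on the interval [a, b], with m = min{X₁, …, Xₙ} and M = max{X₁, …, Xₙ}. Then the estimator b̂ = m + (M − m)/α^(1/(n−1)) satisfies: the probability of the event { b ≤ b̂ } equals 1 − α. That is, b̂ is an upper confidence bound for the unknown upper endpoint b at confidence level 1 − α, constructed without knowledge of the lower endpoint a. -/
open MeasureTheory ProbabilityTheory Set

/-- Uniform law on `[a,b]`. -/
noncomputable def unifLaw (a b : ℝ) : Measure ℝ :=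
  (ENNReal.ofReal (b - a))⁻¹ • volume.restrict (Icc a b)

/-- Admissible values of another sample when `x` is the minimum (`P` decides ties). -/
def goodSet (b c x : ℝ) (P : Prop) : Set ℝ :=
  {y | (x < y ∨ (x = y ∧ P)) ∧ y < x + c * (b - x)}

lemma unifLaw_goodSet {a b c x : ℝ} (hab : a < b) (hc0 : 0 < c) (hc1 : c < 1)
    (hx : x ∈ Icc a b) (P : Prop) :
    unifLaw a b (goodSet b c x P) = ENNReal.ofReal (c * (b - x) / (b - a)) := by
  have hle : x + c * (b - x) ≤ b := by nlinarith [hx.2]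
  have hv : (volume.restrict (Icc a b)) (goodSet b c x P) = ENNReal.ofReal (c * (b - x)) := by
    by_cases hP : P
    · have h : goodSet b c x P = Ico x (x + c * (b - x)) := by
        ext y; simp [goodSet, hP, le_iff_lt_or_eq]
      rw [h, Measure.restrict_apply measurableSet_Ico, inter_eq_left.2, Real.volume_Ico]
      · congr 1; ring
      · intro y hy; exact ⟨hx.1.trans hy.1, hy.2.le.trans hle⟩
    · have h : goodSet b c x P = Ioo x (x + c * (b - x)) := by
        ext y; simp [goodSet, hP]
      rw [h, Measure.restrict_apply measurableSet_Ioo, inter_eq_left.2, Real.volume_Ioo]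
      · congr 1; ring
      · intro y hy; exact ⟨hx.1.trans hy.1.le, hy.2.le.trans hle⟩
  rw [unifLaw, Measure.smul_apply, hv, smul_eq_mul, ENNReal.ofReal_div_of_pos (by linarith),
    ENNReal.div_eq_inv_mul]

lemma integral_eval {a b c : ℝ} (hab : a < b) (hc0 : 0 < c) (k : ℕ) :
    ∫⁻ x, ENNReal.ofReal (c * (b - x) / (b - a)) ^ k ∂(unifLaw a b) =
      ENNReal.ofReal (c ^ k / (k + 1)) := by
  have hba : 0 < b - a := by linarith
  rw [unifLaw, lintegral_smul_measure, smul_eq_mul]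
  have h1 : ∫⁻ x in Icc a b, ENNReal.ofReal (c * (b - x) / (b - a)) ^ k =
      ∫⁻ x in Icc a b, ENNReal.ofReal ((c * (b - x) / (b - a)) ^ k) := by
    refine setLIntegral_congr_fun measurableSet_Icc fun x hx => ?_
    have : 0 ≤ b - x := by linarith [hx.2]
    exact (ENNReal.ofReal_pow (by positivity) k).symm
  rw [h1, ← ofReal_integral_eq_lintegral_ofReal, integral_Icc_eq_integral_Ioc,
    ← intervalIntegral.integral_of_le hab.le]
  · have h2 : ∫ x in a..b, (c * (b - x) / (b - a)) ^ k = (b - a) * (c ^ k / (k + 1)) := by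
      have : ∀ x : ℝ, (c * (b - x) / (b - a)) ^ k = (c / (b - a)) ^ k * (b - x) ^ k := by
        intro x; rw [← mul_pow]; congr 1; ring
      simp_rw [this]
      rw [intervalIntegral.integral_const_mul,
        intervalIntegral.integral_comp_sub_left (fun y => y ^ k) b, integral_pow]
      simp only [sub_self]
      rw [div_pow]
      field_simp
      simp [pow_succ, mul_comm]
    rw [h2, ENNReal.ofReal_mul hba.le, ← mul_assoc, ENNReal.inv_mul_cancel, one_mul]
    · simpa using hba
    · simp
  · exact ContinuousOn.integrableOn_Icc (by fun_prop)
  · refine (ae_restrict_iff' measurableSet_Icc).2 (Filter.Eventually.of_forall fun x hx => ?_)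
    have : 0 ≤ b - x := by linarith [hx.2]
    show 0 ≤ (c * (b - x) / (b - a)) ^ k
    positivity

/-- The event that `i` is the first argmin and all other samples are close. -/
def argEvent (k : ℕ) (b c : ℝ) (i : Fin (k + 1)) : Set (Fin (k + 1) → ℝ) :=
  {f | ∀ j, f (i.succAbove j) ∈ goodSet b c (f i) (i < i.succAbove j)}

def prodEvent (k : ℕ) (b c : ℝ) (i : Fin (k + 1)) : Set (ℝ × (Fin k → ℝ)) :=
  {p | ∀ j, p.2 j ∈ goodSet b c p.1 (i < i.succAbove j)}

lemma meas_prodEvent (k : ℕ) (b c : ℝ) (i : Fin (k + 1)) :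
    MeasurableSet (prodEvent k b c i) := by
  rw [prodEvent, setOf_forall]
  refine MeasurableSet.iInter fun j => ?_
  have h1 : Measurable fun p : ℝ × (Fin k → ℝ) => p.1 := measurable_fst
  have h2 : Measurable fun p : ℝ × (Fin k → ℝ) => p.2 j :=
    (measurable_pi_apply j).comp measurable_snd
  have h3 : Measurable fun p : ℝ × (Fin k → ℝ) => p.1 + c * (b - p.1) := by fun_prop
  exact ((measurableSet_lt h1 h2).union ((measurableSet_eq_fun h1 h2).inter
    (MeasurableSet.const _))).inter (measurableSet_lt h2 h3)

lemma argEvent_eq (k : ℕ) (b c : ℝ) (i : Fin (k + 1)) :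
    argEvent k b c i = MeasurableEquiv.piFinSuccAbove (fun _ => ℝ) i ⁻¹' prodEvent k b c i := by
  ext f; rfl

lemma meas_argEvent (k : ℕ) (b c : ℝ) (i : Fin (k + 1)) :
    MeasurableSet (argEvent k b c i) := by
  rw [argEvent_eq]
  exact (MeasurableEquiv.measurable _) (meas_prodEvent k b c i)

lemma measure_argEvent (k : ℕ) {a b c : ℝ} (hab : a < b) (hc0 : 0 < c) (hc1 : c < 1)
    [IsProbabilityMeasure (unifLaw a b)] (i : Fin (k + 1)) :
    Measure.pi (fun _ : Fin (k + 1) => unifLaw a b) (argEvent k b c i) =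
      ENNReal.ofReal (c ^ k / (k + 1)) := by
  rw [argEvent_eq, (measurePreserving_piFinSuccAbove (fun _ => unifLaw a b) i).measure_preimage
    (meas_prodEvent k b c i).nullMeasurableSet, Measure.prod_apply (meas_prodEvent k b c i),
    ← integral_eval hab hc0 k]
  refine lintegral_congr_ae ?_
  have hae : ∀ᵐ x ∂(unifLaw a b), x ∈ Icc a b :=
    Measure.ae_smul_measure (ae_restrict_mem measurableSet_Icc) _
  filter_upwards [hae] with x hx
  have : Prod.mk x ⁻¹' prodEvent k b c i =
      Set.pi univ fun j => goodSet b c x (i < i.succAbove j) := by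
    ext f; simp [prodEvent]
  rw [this, Measure.pi_pi]
  simp [unifLaw_goodSet hab hc0 hc1 hx]

lemma mem_argEvent {k : ℕ} {b c : ℝ} {i : Fin (k + 1)} {f : Fin (k + 1) → ℝ} :
    f ∈ argEvent k b c i ↔
      ∀ j, j ≠ i → (f i < f j ∨ (f i = f j ∧ i < j)) ∧ f j < f i + c * (b - f i) := by
  constructor
  · intro h j hj
    obtain ⟨l, rfl⟩ := Fin.exists_succAbove_eq hj
    exact h l
  · intro h j
    exact h _ (Fin.succAbove_ne i j)

lemma disj_argEvent (k : ℕ) (b c : ℝ) :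
    Pairwise (Function.onFun Disjoint (argEvent k b c)) := by
  intro i j hij
  rw [Function.onFun, Set.disjoint_left]
  intro f hi hj
  have h1 := (mem_argEvent.1 hi j hij.symm).1
  have h2 := (mem_argEvent.1 hj i hij).1
  rcases h1 with h1 | ⟨h1, h1'⟩ <;> rcases h2 with h2 | ⟨h2, h2'⟩
  · linarith
  · linarith
  · linarith
  · exact absurd h1' (not_lt.2 h2'.le)

lemma bad_iff (k : ℕ) (hk : 1 ≤ k) {b c : ℝ} (hc0 : 0 < c) (hc1 : c < 1)
    (f : Fin (k + 1) → ℝ) :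
    (¬ b ≤ (⨅ i, f i) + ((⨆ i, f i) - ⨅ i, f i) / c) ↔ f ∈ ⋃ i, argEvent k b c i := by
  have hkey : (¬ b ≤ (⨅ i, f i) + ((⨆ i, f i) - ⨅ i, f i) / c) ↔
      (⨆ i, f i) < (⨅ i, f i) + c * (b - ⨅ i, f i) := by
    rw [not_le, ← lt_sub_iff_add_lt', div_lt_iff₀ hc0]
    constructor <;> intro h <;> linarith
  have hbb : BddBelow (range f) := (finite_range f).bddBelow
  have hba : BddAbove (range f) := (finite_range f).bddAbove
  rw [hkey, mem_iUnion]
  constructor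
  · intro h
    obtain ⟨i0, hi0⟩ := exists_eq_ciInf_of_finite (f := f)
    obtain ⟨i, hi, hmin⟩ := (Set.toFinite {i | f i = ⨅ i, f i}).exists_minimal ⟨i0, hi0⟩
    simp only [mem_setOf_eq] at hi hmin
    refine ⟨i, mem_argEvent.2 fun j hj => ⟨?_, ?_⟩⟩
    · have hle : f i ≤ f j := hi ▸ ciInf_le hbb j
      rcases hle.lt_or_eq with hlt | heq
      · exact Or.inl hlt
      · refine Or.inr ⟨heq, ?_⟩
        by_contra hcon
        have hji : j ≤ i := not_lt.1 hcon
        exact hj (le_antisymm hji (hmin (heq.symm.trans hi) hji))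
    · rw [hi]; exact (le_ciSup hba j).trans_lt h
  · rintro ⟨i, hi⟩
    rw [mem_argEvent] at hi
    have hm : (⨅ i, f i) = f i := by
      refine le_antisymm (ciInf_le hbb i) (le_ciInf fun j => ?_)
      by_cases hj : j = i
      · rw [hj]
      · rcases (hi j hj).1 with h | h
        · exact h.le
        · exact h.1.le
    obtain ⟨j, hj⟩ := exists_eq_ciSup_of_finite (f := f)
    rw [hm, ← hj]
    by_cases hji : j = i
    · have : Nontrivial (Fin (k + 1)) := Fin.nontrivial_iff_two_le.2 (by omega)
      obtain ⟨l, hl⟩ := exists_ne i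
      have h1 := hi l hl
      rw [hji]
      rcases h1.1 with h | h
      · linarith [h1.2]
      · linarith [h1.2, h.1]
    · exact (hi j hji).2

/-- For `n ≥ 2` i.i.d. samples uniform on `[a, b]` (`a < b`) and
`α ∈ (0, 1)`, with `m = min i, X i` and `M = max i, X i`, the estimator
`b̂ = m + (M - m) / α^(1/(n-1))` satisfies `P(b ≤ b̂) = 1 - α`: it is an upper
confidence bound for `b` at level `1 - α`, constructed without knowledge of `a`. -/
theorem uniform_upper_confidence_bound_unknown_lower
    {Ω : Type*} [MeasurableSpace Ω] (μ : Measure Ω) [IsProbabilityMeasure μ]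
    (n : ℕ) (hn : 2 ≤ n) (a b : ℝ) (hab : a < b) (α : ℝ) (hα : α ∈ Ioo (0 : ℝ) 1)
    (X : Fin n → Ω → ℝ) (hmeas : ∀ i, Measurable (X i))
    (hindep : iIndepFun X μ)
    (hunif : ∀ i, Measure.map (X i) μ =
      (ENNReal.ofReal (b - a))⁻¹ • volume.restrict (Icc a b)) :
    μ {ω | b ≤ (⨅ i, X i ω) +
        ((⨆ i, X i ω) - ⨅ i, X i ω) / α ^ ((1 : ℝ) / ((n : ℝ) - 1))} =
      ENNReal.ofReal (1 - α) := by
  obtain ⟨k, rfl⟩ : ∃ k, n = k + 1 := ⟨n - 1, by omega⟩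
  have hk : 1 ≤ k := by omega
  have hk0 : (0 : ℝ) < k := by exact_mod_cast hk
  have hexp : (1 : ℝ) / (((k + 1 : ℕ) : ℝ) - 1) = 1 / k := by push_cast; congr 1; ring
  rw [hexp]
  obtain ⟨hα0, hα1⟩ := hα
  set c : ℝ := α ^ ((1 : ℝ) / k) with hc
  have hc0 : 0 < c := Real.rpow_pos_of_pos hα0 _
  have hc1 : c < 1 := Real.rpow_lt_one hα0.le hα1 (by positivity)
  have hck : c ^ k = α := by
    rw [hc, one_div]; exact Real.rpow_inv_natCast_pow hα0.le (by omega)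
  have hlaw : ∀ i, Measure.map (X i) μ = unifLaw a b := hunif
  have : IsProbabilityMeasure (unifLaw a b) := by
    rw [← hlaw 0]; exact Measure.isProbabilityMeasure_map (hmeas 0).aemeasurable
  have hjoint : Measure.map (fun ω i => X i ω) μ =
      Measure.pi (fun _ : Fin (k + 1) => unifLaw a b) := by
    rw [(iIndepFun_iff_map_fun_eq_pi_map (fun i => (hmeas i).aemeasurable)).1 hindep]
    simp_rw [hlaw]
  have hXm : Measurable (fun ω i => X i ω) := measurable_pi_lambda _ hmeas
  have hU : MeasurableSet (⋃ i, argEvent k b c i) :=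
    MeasurableSet.iUnion fun i => meas_argEvent k b c i
  have hset : {ω | b ≤ (⨅ i, X i ω) + ((⨆ i, X i ω) - ⨅ i, X i ω) / c} =
      ((fun ω i => X i ω) ⁻¹' ⋃ i, argEvent k b c i)ᶜ := by
    ext ω
    have := bad_iff k hk (b := b) hc0 hc1 (fun i => X i ω)
    rw [mem_compl_iff, mem_preimage, ← this, not_not, mem_setOf_eq]
  rw [hset, prob_compl_eq_one_sub (hXm hU), ← Measure.map_apply hXm hU, hjoint,
    measure_iUnion (disj_argEvent k b c) (meas_argEvent k b c)]
  simp_rw [measure_argEvent k hab hc0 hc1]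
  rw [tsum_fintype, Finset.sum_const, Finset.card_univ, Fintype.card_fin, hck,
    ← ENNReal.ofReal_nsmul, ENNReal.ofReal_sub _ hα0.le, ENNReal.ofReal_one]
  congr 2
  rw [nsmul_eq_mul]; push_cast; field_simp
end

section
/- Let n ≥ 2, let a < b be real numbers, and let α ∈ (0, 1). Let X₁, …, Xₙ be independent random variables, each uniformly distributed on the interval [a, b], with m = min{X₁, …, Xₙ} and M = max{X₁, …, Xₙ}. Then the estimator â = M − (M − m)/α^(1/(n−1)) satisfies: the probability of the event { â ≤ a } equals 1 − α. That is, â is a lower confidence bound for the unknown lower endpoint a at confidence level 1 − α, constructed without knowledge of the upper endpoint b. -/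
open MeasureTheory ProbabilityTheory Set

lemma aux_integral (a b c : ℝ) (hab : a < b) (hc : 0 < c) (k : ℕ) :
    (ENNReal.ofReal (b - a))⁻¹ * ∫⁻ x in Icc a b, (ENNReal.ofReal (c * (x - a) / (b - a))) ^ k
      = ENNReal.ofReal (c ^ k / (k + 1)) := by
  have hba : 0 < b - a := sub_pos.2 hab
  have h1 : ∫⁻ x in Icc a b, (ENNReal.ofReal (c * (x - a) / (b - a))) ^ k
      = ∫⁻ x in Icc a b, ENNReal.ofReal ((c * (x - a) / (b - a)) ^ k) := by
    refine setLIntegral_congr_fun measurableSet_Icc fun x hx => ?_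
    have : 0 ≤ x - a := sub_nonneg.2 hx.1
    exact (ENNReal.ofReal_pow (by positivity) k).symm
  have hcont : Continuous fun x : ℝ => (c * (x - a) / (b - a)) ^ k := by fun_prop
  rw [h1, ← ofReal_integral_eq_lintegral_ofReal (hcont.integrableOn_Icc)
    ((ae_restrict_iff' measurableSet_Icc).2 (Filter.Eventually.of_forall fun x hx => by
      have : 0 ≤ x - a := sub_nonneg.2 hx.1
      show (0:ℝ) ≤ _
      positivity)), integral_Icc_eq_integral_Ioc, ← intervalIntegral.integral_of_le hab.le]
  have h2 : ∫ x in a..b, (c * (x - a) / (b - a)) ^ k = c ^ k * (b - a) / (k + 1) := by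
    have h3 : ∀ x : ℝ, (c * (x - a) / (b - a)) ^ k = (c / (b - a)) ^ k * (x - a) ^ k := by
      intro x; rw [← mul_pow]; congr 1; ring
    simp_rw [h3]
    rw [intervalIntegral.integral_const_mul,
      intervalIntegral.integral_comp_sub_right (fun x => x ^ k), integral_pow]
    have : (k : ℝ) + 1 ≠ 0 := by positivity
    simp only [sub_self]
    rw [div_pow]
    field_simp
    simp [pow_succ, mul_comm]
  rw [h2, ← ENNReal.ofReal_inv_of_pos hba, ← ENNReal.ofReal_mul (by positivity)]
  congr 1
  field_simp

lemma aux_prob {Ω : Type*} [MeasurableSpace Ω] (μ : Measure Ω) [IsProbabilityMeasure μ]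
    (k : ℕ) (a b c : ℝ) (hab : a < b) (hc : 0 < c)
    (X : Fin (k + 1) → Ω → ℝ) (hmeas : ∀ i, Measurable (X i))
    (hindep : iIndepFun X μ)
    (hunif : ∀ i, Measure.map (X i) μ =
      (ENNReal.ofReal (b - a))⁻¹ • volume.restrict (Icc a b))
    (T : ℝ → Set ℝ) (hT : MeasurableSet {p : ℝ × ℝ | p.2 ∈ T p.1})
    (hTv : ∀ x ∈ Icc a b, ((ENNReal.ofReal (b - a))⁻¹ • volume.restrict (Icc a b)) (T x)
      = ENNReal.ofReal (c * (x - a) / (b - a)))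
    (j : Fin (k + 1)) :
    MeasurableSet {ω | ∀ i, X (j.succAbove i) ω ∈ T (X j ω)} ∧
    μ {ω | ∀ i, X (j.succAbove i) ω ∈ T (X j ω)} = ENNReal.ofReal (c ^ k / (k + 1)) := by
  set ν : Measure ℝ := (ENNReal.ofReal (b - a))⁻¹ • volume.restrict (Icc a b) with hν
  have hνp : IsProbabilityMeasure ν := by
    rw [← hunif j]; exact Measure.isProbabilityMeasure_map (hmeas j).aemeasurable
  have hjoint : Measure.map (fun ω i => X i ω) μ = Measure.pi fun _ => ν := by
    rw [(iIndepFun_iff_map_fun_eq_pi_map (fun i => (hmeas i).aemeasurable)).1 hindep]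
    simp_rw [hunif]
  let S : Set (ℝ × (Fin k → ℝ)) := {p | ∀ i, p.2 i ∈ T p.1}
  have hS : MeasurableSet S := by
    have : S = ⋂ i, (fun p : ℝ × (Fin k → ℝ) => (p.1, p.2 i)) ⁻¹' {p : ℝ × ℝ | p.2 ∈ T p.1} := by
      ext p; simp [S]
    rw [this]
    refine MeasurableSet.iInter fun i => ?_
    exact (by fun_prop : Measurable (fun p : ℝ × (Fin k → ℝ) => (p.1, p.2 i))) hT
  have hX : Measurable (fun ω i => X i ω) := measurable_pi_lambda _ hmeas
  have hmp := measurePreserving_piFinSuccAbove (fun _ : Fin (k + 1) => ν) j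
  have hset : {ω | ∀ i, X (j.succAbove i) ω ∈ T (X j ω)} =
      (fun ω i => X i ω) ⁻¹' (MeasurableEquiv.piFinSuccAbove (fun _ => ℝ) j ⁻¹' S) := by
    ext ω; exact Iff.rfl
  have hm2 := hmp.measurable hS
  refine ⟨hset ▸ hX hm2, ?_⟩
  rw [hset, ← Measure.map_apply hX hm2, hjoint, hmp.measure_preimage hS.nullMeasurableSet,
    Measure.prod_apply hS]
  have h1 : ∀ x, (Measure.pi fun _ : Fin k => ν) (Prod.mk x ⁻¹' S) = ν (T x) ^ k := by
    intro x
    have : Prod.mk x ⁻¹' S = univ.pi fun _ => T x := by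
      ext y; simp [S]
    rw [this, Measure.pi_pi]; simp
  simp_rw [h1]
  rw [← aux_integral a b c hab hc k]
  conv_lhs => rw [hν]
  rw [lintegral_smul_measure, smul_eq_mul]
  congr 1
  refine setLIntegral_congr_fun measurableSet_Icc fun x hx => ?_
  show ν (T x) ^ k = _
  rw [hTv x hx]

/-- For `n ≥ 2` i.i.d. samples uniform on `[a, b]` (`a < b`) and
`α ∈ (0, 1)`, with `m = min i, X i` and `M = max i, X i`, the estimator
`â = M - (M - m) / α^(1/(n-1))` satisfies `P(â ≤ a) = 1 - α`: it is a lower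
confidence bound for `a` at level `1 - α`, constructed without knowledge of `b`. -/
theorem uniform_lower_confidence_bound_unknown_upper
    {Ω : Type*} [MeasurableSpace Ω] (μ : Measure Ω) [IsProbabilityMeasure μ]
    (n : ℕ) (hn : 2 ≤ n) (a b : ℝ) (hab : a < b) (α : ℝ) (hα : α ∈ Ioo (0 : ℝ) 1)
    (X : Fin n → Ω → ℝ) (hmeas : ∀ i, Measurable (X i))
    (hindep : iIndepFun X μ)
    (hunif : ∀ i, Measure.map (X i) μ =
      (ENNReal.ofReal (b - a))⁻¹ • volume.restrict (Icc a b)) :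
    μ {ω | (⨆ i, X i ω) -
        ((⨆ i, X i ω) - ⨅ i, X i ω) / α ^ ((1 : ℝ) / ((n : ℝ) - 1)) ≤ a} =
      ENNReal.ofReal (1 - α) := by
  obtain ⟨k, rfl⟩ : ∃ k, n = k + 1 := ⟨n - 1, by omega⟩
  have hk : 1 ≤ k := by omega
  have hk0 : (k : ℝ) ≠ 0 := by positivity
  have hba : 0 < b - a := sub_pos.2 hab
  obtain ⟨hα0, hα1⟩ := hα
  set c : ℝ := α ^ ((1 : ℝ) / (((k + 1 : ℕ) : ℝ) - 1)) with hcdef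
  have hexp : (1 : ℝ) / (((k + 1 : ℕ) : ℝ) - 1) = 1 / k := by push_cast; simp
  have hc0 : 0 < c := Real.rpow_pos_of_pos hα0 _
  have hc1 : c < 1 := Real.rpow_lt_one hα0.le hα1 (by rw [hexp]; positivity)
  have hck : c ^ k = α := by
    rw [hcdef, hexp, ← Real.rpow_natCast, ← Real.rpow_mul hα0.le]
    simp [hk0]
  clear_value c
  let lo : ℝ → ℝ := fun x => a + (1 - c) * (x - a)
  have hlo : Continuous lo := by fun_prop
  have hlov : ∀ x ∈ Icc a b, a ≤ lo x ∧ x - lo x = c * (x - a) := by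
    intro x hx
    have : 0 ≤ (1 - c) * (x - a) := mul_nonneg (by linarith) (by linarith [hx.1])
    exact ⟨by simp only [lo]; linarith, by simp only [lo]; ring⟩
  have hfin : ∀ x ∈ Icc a b, (ENNReal.ofReal (b - a))⁻¹ * ENNReal.ofReal (x - lo x)
      = ENNReal.ofReal (c * (x - a) / (b - a)) := by
    intro x hx
    rw [(hlov x hx).2, ← ENNReal.ofReal_inv_of_pos hba, ← ENNReal.ofReal_mul (by positivity)]
    congr 1; field_simp
  have hE := aux_prob μ k a b c hab hc0 X hmeas hindep hunif (fun x => Ioo (lo x) x)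
    ((measurableSet_lt (hlo.measurable.comp measurable_fst) measurable_snd).inter
      (measurableSet_lt measurable_snd measurable_fst))
    (by
      intro x hx
      rw [Measure.smul_apply, Measure.restrict_apply measurableSet_Ioo, inter_eq_left.2,
        Real.volume_Ioo, smul_eq_mul, hfin x hx]
      exact fun y hy => ⟨(hlov x hx).1.trans hy.1.le, hy.2.le.trans hx.2⟩)
  have hF := aux_prob μ k a b c hab hc0 X hmeas hindep hunif (fun x => Ioc (lo x) x)
    ((measurableSet_lt (hlo.measurable.comp measurable_fst) measurable_snd).inter
      (measurableSet_le measurable_snd measurable_fst))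
    (by
      intro x hx
      rw [Measure.smul_apply, Measure.restrict_apply measurableSet_Ioc, inter_eq_left.2,
        Real.volume_Ioc, smul_eq_mul, hfin x hx]
      exact fun y hy => ⟨(hlov x hx).1.trans hy.1.le, hy.2.trans hx.2⟩)
  set A : Set Ω := {ω | (⨆ i, X i ω) - ((⨆ i, X i ω) - ⨅ i, X i ω) / c ≤ a} with hA
  have hAm : MeasurableSet A := by
    have h1 : Measurable fun ω => ⨆ i, X i ω := Measurable.iSup hmeas
    have h2 : Measurable fun ω => ⨅ i, X i ω := Measurable.iInf hmeas
    exact measurableSet_le (h1.sub ((h1.sub h2).div_const c)) measurable_const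
  have hAc : ∀ ω, ω ∈ Aᶜ ↔ lo (⨆ i, X i ω) < ⨅ i, X i ω := by
    intro ω
    simp only [hA, mem_compl_iff, mem_ofPred_eq, not_le, lo]
    rw [lt_sub_iff_add_lt, ← lt_sub_iff_add_lt', div_lt_iff₀ hc0]
    constructor <;> intro h <;> linarith
  have hsum : ∑ _j : Fin (k + 1), ENNReal.ofReal (c ^ k / (k + 1)) = ENNReal.ofReal α := by
    rw [Finset.sum_const, Finset.card_univ, Fintype.card_fin, nsmul_eq_mul,
      ← ENNReal.ofReal_natCast, ← ENNReal.ofReal_mul (by positivity), hck]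
    congr 1; push_cast; field_simp
  have hle : μ Aᶜ ≤ ENNReal.ofReal α := by
    have hsub : Aᶜ ⊆ ⋃ j, {ω | ∀ i, X (j.succAbove i) ω ∈ Ioc (lo (X j ω)) (X j ω)} := by
      intro ω hω
      rw [hAc] at hω
      obtain ⟨j, hj⟩ := exists_eq_ciSup_of_finite (f := fun i => X i ω)
      refine mem_iUnion.2 ⟨j, fun i => ?_⟩
      rw [hj]
      exact ⟨hω.trans_le (ciInf_le (finite_range _).bddBelow _),
        le_ciSup (f := fun i => X i ω) (finite_range _).bddAbove _⟩
    calc μ Aᶜ ≤ _ := measure_mono hsub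
      _ ≤ _ := measure_iUnion_fintype_le μ _
      _ = _ := by rw [← hsum]; exact Finset.sum_congr rfl fun j _ => (hF j).2
  have hge : ENNReal.ofReal α ≤ μ Aᶜ := by
    have hsub : (⋃ j, {ω | ∀ i, X (j.succAbove i) ω ∈ Ioo (lo (X j ω)) (X j ω)}) ⊆ Aᶜ := by
      intro ω hω
      obtain ⟨j, hj⟩ := mem_iUnion.1 hω
      have hj : ∀ i, X (j.succAbove i) ω ∈ Ioo (lo (X j ω)) (X j ω) := hj
      have hall : ∀ i, lo (X j ω) < X i ω ∧ X i ω ≤ X j ω := by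
        intro i
        rcases Fin.eq_self_or_eq_succAbove j i with rfl | ⟨i, rfl⟩
        · have := hj ⟨0, hk⟩
          exact ⟨this.1.trans this.2, le_rfl⟩
        · exact ⟨(hj i).1, (hj i).2.le⟩
      have hsup : ⨆ i, X i ω = X j ω := le_antisymm (ciSup_le fun i => (hall i).2)
        (le_ciSup (f := fun i => X i ω) (finite_range _).bddAbove j)
      rw [hAc, hsup]
      obtain ⟨i, hi⟩ := exists_eq_ciInf_of_finite (f := fun i => X i ω)
      rw [← hi]
      exact (hall i).1
    refine le_trans (le_of_eq ?_) (measure_mono hsub)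
    rw [measure_iUnion ?_ fun j => (hE j).1, tsum_fintype, ← hsum]
    · exact Finset.sum_congr rfl fun j _ => (hE j).2.symm
    · intro j l hjl
      refine disjoint_left.2 fun ω h1 h2 => ?_
      obtain ⟨i, hi⟩ := Fin.exists_succAbove_eq hjl.symm
      obtain ⟨i', hi'⟩ := Fin.exists_succAbove_eq hjl
      have e1 := (h1 i).2
      have e2 := (h2 i').2
      rw [hi] at e1
      rw [hi'] at e2
      exact lt_asymm e1 e2
  have hfinal := prob_compl_eq_one_sub (μ := μ) hAm.compl
  rw [compl_compl, le_antisymm hle hge] at hfinal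
  rw [hfinal, ENNReal.ofReal_sub _ hα0.le, ENNReal.ofReal_one]
end

section
/- Let n ≥ 2, let a < b be real numbers with a_min ≤ a for a known constant a_min, and let α ∈ (0, 1). Let X₁, …, Xₙ be independent random variables, each uniformly distributed on the interval [a, b], with m = min{X₁, …, Xₙ} and M = max{X₁, …, Xₙ}. Then the clipped estimator â' = max( a_min, M − (M − m)/α^(1/(n−1)) ) satisfies: the probability of the event { â' ≤ a } is at least 1 − α. -/
open MeasureTheory ProbabilityTheory Set

lemma aux_lintegral (a b c : ℝ) (hab : a < b) (hc : 0 ≤ c) (k : ℕ) :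
    ∫⁻ x in Icc a b, (ENNReal.ofReal ((b - a)⁻¹ * (c * (x - a)))) ^ k
      = ENNReal.ofReal (c ^ k * (b - a) / (k + 1)) := by
  have hba : 0 < b - a := sub_pos.2 hab
  have h1 : ∫⁻ x in Icc a b, (ENNReal.ofReal ((b - a)⁻¹ * (c * (x - a)))) ^ k
      = ∫⁻ x in Icc a b, ENNReal.ofReal (((b - a)⁻¹ * (c * (x - a))) ^ k) := by
    refine setLIntegral_congr_fun measurableSet_Icc fun x hx => ?_
    have : 0 ≤ x - a := sub_nonneg.2 hx.1
    exact (ENNReal.ofReal_pow (by positivity) k).symm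
  rw [h1, ← ofReal_integral_eq_lintegral_ofReal]
  · congr 1
    rw [integral_Icc_eq_integral_Ioc, ← intervalIntegral.integral_of_le hab.le]
    have h2 : ∀ x : ℝ, ((b - a)⁻¹ * (c * (x - a))) ^ k = ((b - a)⁻¹ * c) ^ k * (x - a) ^ k := by
      intro x; rw [← mul_pow]; ring
    simp_rw [h2]
    rw [intervalIntegral.integral_const_mul,
      intervalIntegral.integral_comp_sub_right (fun x => x ^ k) a, integral_pow]
    simp only [sub_self, mul_pow, inv_pow]
    rw [zero_pow (Nat.succ_ne_zero k), sub_zero, pow_succ]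
    field_simp
  · exact (Continuous.continuousOn (by fun_prop)).integrableOn_Icc
  · filter_upwards [ae_restrict_mem measurableSet_Icc] with x hx
    have : 0 ≤ x - a := sub_nonneg.2 hx.1
    simp only [Pi.zero_apply]
    positivity

lemma aux_pi (a b c : ℝ) (hab : a < b) (hc : 0 ≤ c) (k : ℕ) (ν : Measure ℝ)
    [IsProbabilityMeasure ν]
    (hν : ν = (ENNReal.ofReal (b - a))⁻¹ • volume.restrict (Icc a b)) (i : Fin (k + 1)) :
    Measure.pi (fun _ : Fin (k + 1) => ν)
      {x | ∀ j : Fin k, x (i.succAbove j) ∈ Ioc (x i - c * (x i - a)) (x i)}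
      ≤ ENNReal.ofReal (c ^ k / (k + 1)) := by
  have hba : 0 < b - a := sub_pos.2 hab
  have hinv : (ENNReal.ofReal (b - a))⁻¹ = ENNReal.ofReal (b - a)⁻¹ :=
    (ENNReal.ofReal_inv_of_pos hba).symm
  have hmp := measurePreserving_piFinSuccAbove (fun _ : Fin (k + 1) => ν) i
  let S : Set (ℝ × (Fin k → ℝ)) := {p | ∀ j, p.2 j ∈ Ioc (p.1 - c * (p.1 - a)) p.1}
  have hS : MeasurableSet S := by
    have : S = ⋂ j, ({p | p.1 - c * (p.1 - a) < p.2 j} ∩ {p | p.2 j ≤ p.1}) := by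
      ext p; simp [S]
    rw [this]
    refine MeasurableSet.iInter fun j => ?_
    exact (measurableSet_lt (by fun_prop) (by fun_prop)).inter
      (measurableSet_le (by fun_prop) (by fun_prop))
  have h1 : {x : Fin (k + 1) → ℝ | ∀ j : Fin k,
      x (i.succAbove j) ∈ Ioc (x i - c * (x i - a)) (x i)}
      = (MeasurableEquiv.piFinSuccAbove (fun _ => ℝ) i) ⁻¹' S := by
    ext x; rfl
  rw [h1, hmp.measure_preimage hS.nullMeasurableSet, Measure.prod_apply hS]
  have h2 : ∀ x, Measure.pi (fun _ : Fin k => ν) (Prod.mk x ⁻¹' S)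
      ≤ (ENNReal.ofReal ((b - a)⁻¹ * (c * (x - a)))) ^ k := by
    intro x
    have : Prod.mk x ⁻¹' S = Set.pi univ (fun _ : Fin k => Ioc (x - c * (x - a)) x) := by
      ext y; simp [S]
    rw [this, Measure.pi_pi]
    simp only [Finset.prod_const, Finset.card_univ, Fintype.card_fin]
    gcongr
    rw [hν, hinv, ENNReal.ofReal_mul (by positivity)]
    simp only [Measure.smul_apply, smul_eq_mul]
    gcongr
    refine (Measure.restrict_apply_le _ _).trans ?_
    rw [Real.volume_Ioc]
    simp
  refine (lintegral_mono h2).trans ?_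
  conv_lhs => rw [hν]
  rw [lintegral_smul_measure, aux_lintegral a b c hab hc, hinv, smul_eq_mul,
    ← ENNReal.ofReal_mul (by positivity)]
  apply le_of_eq
  congr 1
  field_simp


/-- For `n ≥ 2` i.i.d. samples uniform on `[a, b]` (`a_min ≤ a < b`)
and `α ∈ (0, 1)`, with `m = min i, X i` and `M = max i, X i`, the clipped
estimator `â' = max(a_min, M - (M - m)/α^(1/(n-1)))` satisfies
`P(â' ≤ a) ≥ 1 - α`. -/
theorem uniform_clipped_lower_confidence_bound
    {Ω : Type*} [MeasurableSpace Ω] (μ : Measure Ω) [IsProbabilityMeasure μ]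
    (n : ℕ) (hn : 2 ≤ n) (a b amin : ℝ) (hab : a < b) (hamin : amin ≤ a)
    (α : ℝ) (hα : α ∈ Ioo (0 : ℝ) 1)
    (X : Fin n → Ω → ℝ) (hmeas : ∀ i, Measurable (X i))
    (hindep : iIndepFun X μ)
    (hunif : ∀ i, Measure.map (X i) μ =
      (ENNReal.ofReal (b - a))⁻¹ • volume.restrict (Icc a b)) :
    ENNReal.ofReal (1 - α) ≤
      μ {ω | max amin ((⨆ i, X i ω) -
        ((⨆ i, X i ω) - ⨅ i, X i ω) / α ^ ((1 : ℝ) / ((n : ℝ) - 1))) ≤ a} := by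
  obtain ⟨k, rfl⟩ : ∃ k, n = k + 1 := ⟨n - 1, by omega⟩
  have hk : 1 ≤ k := by omega
  obtain ⟨hα0, hα1⟩ := hα
  push_cast
  rw [add_sub_cancel_right]
  set c : ℝ := α ^ ((1 : ℝ) / (k : ℝ)) with hcdef
  have hc : 0 < c := Real.rpow_pos_of_pos hα0 _
  have hck : c ^ k = α := by
    rw [hcdef, one_div]
    exact Real.rpow_inv_natCast_pow hα0.le (by omega)
  set ν : Measure ℝ := (ENNReal.ofReal (b - a))⁻¹ • volume.restrict (Icc a b) with hν
  haveI : IsProbabilityMeasure ν := by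
    rw [← hunif 0]
    exact Measure.isProbabilityMeasure_map (hmeas 0).aemeasurable
  have hmap : μ.map (fun ω i => X i ω) = Measure.pi (fun _ : Fin (k + 1) => ν) := by
    rw [(iIndepFun_iff_map_fun_eq_pi_map (fun i => (hmeas i).aemeasurable)).1 hindep]
    congr 1
    funext i
    exact hunif i
  set G : Set Ω := {ω | max amin ((⨆ i, X i ω) - ((⨆ i, X i ω) - ⨅ i, X i ω) / c) ≤ a} with hG
  let T : Fin (k + 1) → Set (Fin (k + 1) → ℝ) := fun i =>
    {x | ∀ j : Fin k, x (i.succAbove j) ∈ Ioc (x i - c * (x i - a)) (x i)}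
  have hsub : Gᶜ ⊆ ⋃ i, (fun ω i => X i ω) ⁻¹' T i := by
    intro ω hω
    simp only [hG, mem_compl_iff, mem_setOf_eq, max_le_iff, not_and, not_le] at hω
    have h := hω hamin
    obtain ⟨i, hi⟩ := exists_eq_ciSup_of_finite (f := fun i => X i ω)
    refine mem_iUnion.2 ⟨i, fun j => ?_⟩
    have hle : X (i.succAbove j) ω ≤ X i ω := by
      rw [hi]; exact le_ciSup (f := fun i => X i ω) (Set.finite_range _).bddAbove _
    have hge : (⨅ i, X i ω) ≤ X (i.succAbove j) ω :=
      ciInf_le (f := fun i => X i ω) (Set.finite_range _).bddBelow _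
    rw [← hi] at h
    have h3 : (X i ω - ⨅ i, X i ω) / c < X i ω - a := by linarith
    rw [div_lt_iff₀ hc] at h3
    refine ⟨?_, hle⟩
    change X i ω - c * (X i ω - a) < X (i.succAbove j) ω
    linarith
  have hbad : μ Gᶜ ≤ ENNReal.ofReal α := by
    calc μ Gᶜ ≤ μ (⋃ i, (fun ω i => X i ω) ⁻¹' T i) := measure_mono hsub
      _ ≤ ∑ i, μ ((fun ω i => X i ω) ⁻¹' T i) := measure_iUnion_fintype_le _ _
      _ ≤ ∑ _i : Fin (k + 1), ENNReal.ofReal (c ^ k / (k + 1)) := by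
        refine Finset.sum_le_sum fun i _ => ?_
        refine (Measure.le_map_apply (measurable_pi_lambda _ hmeas).aemeasurable _).trans ?_
        rw [hmap]
        exact aux_pi a b c hab hc.le k ν hν i
      _ = ENNReal.ofReal α := by
        rw [← ENNReal.ofReal_sum_of_nonneg (fun _ _ => by positivity)]
        congr 1
        simp only [Finset.sum_const, Finset.card_univ, Fintype.card_fin, nsmul_eq_mul]
        rw [hck]
        push_cast
        field_simp
  have h1 : 1 ≤ μ G + μ Gᶜ := by
    rw [← measure_univ (μ := μ), ← union_compl_self G]
    exact measure_union_le _ _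
  rw [ENNReal.ofReal_sub _ hα0.le, ENNReal.ofReal_one]
  exact tsub_le_iff_right.2 (h1.trans (by gcongr))
end
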